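/- Let C₃, D₃, C₄, D₄ and E₁ be quaternion matrices of conformable sizes, and set M₁ := R_{C₃}C₄, N₁ := D₄L_{D₃}, S₁ := C₄L_{M₁}. Suppose the matrix equation C₃X₃D₃ + C₄X₄D₄ = E₁ is consistent. Then a pair (X₃, X₄) satisfies C₃X₃D₃ + C₄X₄D₄ = E₁ if and only if there exist quaternion matrices Y₁₁, Y₁₂, Y₁₃, Y₁₄, Y₁₅ of appropriate sizes such that X₃ = C₃†E₁D₃† − C₃†C₄M₁†E₁D₃† − C₃†S₁C₄†E₁N₁†D₄D₃† − C₃†S₁Y₁₁R_{N₁}D₄D₃† + L_{C₃}Y₁₂ + Y₁₃R_{D₃} and X₄ = M₁†E₁D₄† + S₁†S₁C₄†E₁N₁† + L_{M₁}L_{S₁}Y₁₄ + Y₁₅R_{D₄} + L_{M₁}Y₁₁R_{N₁}. -/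

import Mathlib

open scoped Quaternion Classical
open Matrix

noncomputable section

/-- The four Moore–Penrose conditions for `X` to be the Moore–Penrose inverse of `A`
over the real quaternions. -/
def IsMP {m n : Type*} [Fintype m] [Fintype n]
    (A : Matrix m n ℍ[ℝ]) (X : Matrix n m ℍ[ℝ]) : Prop :=
  A * X * A = A ∧ X * A * X = X ∧ (A * X)ᴴ = A * X ∧ (X * A)ᴴ = X * A

/-- The Moore–Penrose inverse `A†` of a quaternion matrix (it exists and is unique). -/
def dg {m n : Type*} [Fintype m] [Fintype n]
    (A : Matrix m n ℍ[ℝ]) : Matrix n m ℍ[ℝ] :=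
  if h : ∃ X, IsMP A X then h.choose else 0

/-- `L_A = I - A† A`. -/
def lproj {m n : Type*} [Fintype m] [Fintype n] [DecidableEq n]
    (A : Matrix m n ℍ[ℝ]) : Matrix n n ℍ[ℝ] :=
  1 - dg A * A

/-- `R_A = I - A A†`. -/
def rproj {m n : Type*} [Fintype m] [Fintype n] [DecidableEq m]
    (A : Matrix m n ℍ[ℝ]) : Matrix m m ℍ[ℝ] :=
  1 - A * dg A

section MoorePenrose

variable {l m n : Type*} [Fintype m] [Fintype n]

/-- Quaternion conjugate transposition is proper: `A* A Z = 0` forces `A Z = 0`. -/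
theorem quat_mul_eq_zero_of_conjTranspose_mul (A : Matrix m n ℍ[ℝ]) (Z : Matrix n l ℍ[ℝ])
    (h : Aᴴ * A * Z = 0) : A * Z = 0 := by
  have h0 : (A * Z)ᴴ * (A * Z) = 0 := by
    rw [conjTranspose_mul, Matrix.mul_assoc, ← Matrix.mul_assoc Aᴴ, h, Matrix.mul_zero]
  ext1 i j
  have hj : ∑ k, Quaternion.normSq ((A * Z) k j) = 0 := by
    have := congrArg QuaternionAlgebra.re (congrFun (congrFun h0 j) j)
    rw [Matrix.mul_apply] at this
    simp only [conjTranspose_apply, Quaternion.star_mul_self] at this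
    have hc : ∑ k, ((Quaternion.normSq ((A * Z) k j) : ℝ) : ℍ[ℝ])
        = ((∑ k, Quaternion.normSq ((A * Z) k j) : ℝ) : ℍ[ℝ]) :=
      (map_sum (algebraMap ℝ ℍ[ℝ]) _ _).symm
    rw [hc] at this
    simpa using this
  have := (Finset.sum_eq_zero_iff_of_nonneg (fun k _ => Quaternion.normSq_nonneg)).1 hj i
    (Finset.mem_univ i)
  simpa using this

theorem quat_exists_mul_conjTranspose_mul_eq (A : Matrix m n ℍ[ℝ]) :
    ∃ R : Matrix m n ℍ[ℝ], A * Aᴴ * R = A := by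
  let f : Matrix n n ℍ[ℝ] →ₗ[ℝ] Matrix n n ℍ[ℝ] := LinearMap.mulLeft ℝ (Aᴴ * A)
  have hd : Disjoint (LinearMap.range f) (LinearMap.ker f) := by
    rw [Submodule.disjoint_def]
    rintro _ ⟨y, rfl⟩ hy
    have h1 : Aᴴ * A * ((Aᴴ * A) * y) = 0 := hy
    have h2 : A * ((Aᴴ * A) * y) = 0 := quat_mul_eq_zero_of_conjTranspose_mul _ _ h1
    have h3 : (Aᴴ * A)ᴴ * (Aᴴ * A) * y = 0 := by
      rw [conjTranspose_mul, conjTranspose_conjTranspose, Matrix.mul_assoc, Matrix.mul_assoc, h2,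
        Matrix.mul_zero]
    exact quat_mul_eq_zero_of_conjTranspose_mul _ _ h3
  have htop : LinearMap.range f ⊔ LinearMap.ker f = ⊤ :=
    Submodule.eq_top_of_disjoint _ _ (LinearMap.finrank_range_add_finrank_ker f).ge hd
  obtain ⟨_, ⟨z, rfl⟩, k, hk, hzk⟩ := Submodule.mem_sup.1
    (htop ▸ Submodule.mem_top : (1 : Matrix n n ℍ[ℝ]) ∈ LinearMap.range f ⊔ LinearMap.ker f)
  have hAk : A * k = 0 := quat_mul_eq_zero_of_conjTranspose_mul _ _ hk
  refine ⟨A * z, ?_⟩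
  calc A * Aᴴ * (A * z) = A * (Aᴴ * A * z + k) := by
        rw [Matrix.mul_add, hAk, add_zero]; simp only [Matrix.mul_assoc]
    _ = A := by
        change A * (f z + k) = A
        rw [hzk, Matrix.mul_one]

theorem exists_isMP (A : Matrix m n ℍ[ℝ]) : ∃ X, IsMP A X := by
  obtain ⟨R, hR⟩ := quat_exists_mul_conjTranspose_mul_eq A
  obtain ⟨T, hT⟩ := quat_exists_mul_conjTranspose_mul_eq Aᴴ
  rw [conjTranspose_conjTranspose] at hT
  have hT' : Tᴴ * Aᴴ * A = A := by
    simpa [Matrix.mul_assoc] using congrArg conjTranspose hT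
  have hsT : Tᴴ * Aᴴ = A * T := by
    conv_lhs => rw [← hT]
    rw [← Matrix.mul_assoc, ← Matrix.mul_assoc, hT']
  have hR' : Rᴴ * A * Aᴴ = Aᴴ := by
    simpa [Matrix.mul_assoc] using congrArg conjTranspose hR
  have hsR : Rᴴ * A = Aᴴ * R := by
    conv_lhs => rw [← hR]
    rw [← Matrix.mul_assoc, ← Matrix.mul_assoc, hR']
  have hATA : A * T * A = A := by rw [← hsT, hT']
  have hARA : A * Rᴴ * A = A := by rw [Matrix.mul_assoc, hsR, ← Matrix.mul_assoc, hR]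
  have hl : A * (Rᴴ * A * T) = A * T := by
    rw [← Matrix.mul_assoc, ← Matrix.mul_assoc, hARA]
  have hr : Rᴴ * A * T * A = Rᴴ * A := by
    rw [Matrix.mul_assoc, Matrix.mul_assoc, ← Matrix.mul_assoc A, hATA]
  refine ⟨Rᴴ * A * T, ?_, ?_, ?_, ?_⟩
  · rw [hl, hATA]
  · rw [hr, Matrix.mul_assoc, hl, Matrix.mul_assoc]
  · rw [hl, conjTranspose_mul, hsT]
  · rw [hr, conjTranspose_mul, conjTranspose_conjTranspose, hsR]

theorem isMP_dg (A : Matrix m n ℍ[ℝ]) : IsMP A (dg A) := by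
  rw [dg, dif_pos (exists_isMP A)]
  exact (exists_isMP A).choose_spec

theorem mul_dg_mul (A : Matrix m n ℍ[ℝ]) : A * dg A * A = A := (isMP_dg A).1

/-- A Hermitian left identity of `A` is a right identity of `A†`. -/
theorem dg_mul_of_mul_eq {A : Matrix m n ℍ[ℝ]} {P : Matrix m m ℍ[ℝ]} (hP : Pᴴ = P)
    (h : P * A = A) : dg A * P = dg A := by
  obtain ⟨-, h2, h3, -⟩ := isMP_dg A
  have : A * dg A * P = A * dg A := by
    rw [← h3]
    nth_rw 1 [← hP]
    rw [← conjTranspose_mul, ← Matrix.mul_assoc, h]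
  rw [← h2, Matrix.mul_assoc, Matrix.mul_assoc, ← Matrix.mul_assoc A, this,
    Matrix.mul_assoc]

/-- A Hermitian right identity of `A` is a left identity of `A†`. -/
theorem mul_dg_of_mul_eq {A : Matrix m n ℍ[ℝ]} {P : Matrix n n ℍ[ℝ]} (hP : Pᴴ = P)
    (h : A * P = A) : P * dg A = dg A := by
  obtain ⟨-, h2, -, h4⟩ := isMP_dg A
  have : P * (dg A * A) = dg A * A := by
    rw [← h4]
    nth_rw 1 [← hP]
    rw [← conjTranspose_mul, Matrix.mul_assoc, h]
  rw [← h2, ← Matrix.mul_assoc, this]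

theorem mul_lproj [DecidableEq n] (A : Matrix m n ℍ[ℝ]) : A * lproj A = 0 := by
  rw [lproj, Matrix.mul_sub, Matrix.mul_one, ← Matrix.mul_assoc, mul_dg_mul, sub_self]

theorem rproj_mul [DecidableEq m] (A : Matrix m n ℍ[ℝ]) : rproj A * A = 0 := by
  rw [rproj, Matrix.sub_mul, Matrix.one_mul, mul_dg_mul, sub_self]

theorem conjTranspose_lproj [DecidableEq n] (A : Matrix m n ℍ[ℝ]) : (lproj A)ᴴ = lproj A := by
  rw [lproj, conjTranspose_sub, conjTranspose_one, (isMP_dg A).2.2.2]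

theorem conjTranspose_rproj [DecidableEq m] (A : Matrix m n ℍ[ℝ]) : (rproj A)ᴴ = rproj A := by
  rw [rproj, conjTranspose_sub, conjTranspose_one, (isMP_dg A).2.2.1]

theorem lproj_mul_lproj [DecidableEq n] (A : Matrix m n ℍ[ℝ]) : lproj A * lproj A = lproj A := by
  conv_lhs => arg 1; rw [lproj]
  rw [Matrix.sub_mul, Matrix.one_mul, Matrix.mul_assoc, mul_lproj, Matrix.mul_zero, sub_zero]

theorem rproj_mul_rproj [DecidableEq m] (A : Matrix m n ℍ[ℝ]) : rproj A * rproj A = rproj A := by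
  conv_lhs => arg 2; rw [rproj]
  rw [Matrix.mul_sub, Matrix.mul_one, ← Matrix.mul_assoc, rproj_mul, Matrix.zero_mul, sub_zero]

theorem dg_rproj_mul_mul_rproj [Fintype l] [DecidableEq m] (A : Matrix m n ℍ[ℝ]) (C : Matrix m l ℍ[ℝ]) :
    dg (rproj A * C) * rproj A = dg (rproj A * C) :=
  dg_mul_of_mul_eq (conjTranspose_rproj A) (by rw [← Matrix.mul_assoc, rproj_mul_rproj])

theorem lproj_mul_dg_mul_lproj [Fintype l] [DecidableEq n] (B : Matrix m n ℍ[ℝ]) (D : Matrix l n ℍ[ℝ]) :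
    lproj B * dg (D * lproj B) = dg (D * lproj B) :=
  mul_dg_of_mul_eq (conjTranspose_lproj B) (by rw [Matrix.mul_assoc, lproj_mul_lproj])

end MoorePenrose

/-- General solution of `C₃X₃D₃ + C₄X₄D₄ = E₁`, assuming consistency. -/
theorem quat_twoSided_pair_general_solution {p q m₃ n₃ m₄ n₄ : ℕ}
    (C₃ : Matrix (Fin p) (Fin m₃) ℍ[ℝ]) (D₃ : Matrix (Fin n₃) (Fin q) ℍ[ℝ])
    (C₄ : Matrix (Fin p) (Fin m₄) ℍ[ℝ]) (D₄ : Matrix (Fin n₄) (Fin q) ℍ[ℝ])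
    (E₁ : Matrix (Fin p) (Fin q) ℍ[ℝ])
    (hcons : ∃ (X₃ : Matrix (Fin m₃) (Fin n₃) ℍ[ℝ]) (X₄ : Matrix (Fin m₄) (Fin n₄) ℍ[ℝ]),
      C₃ * X₃ * D₃ + C₄ * X₄ * D₄ = E₁) :
    let M₁ := rproj C₃ * C₄
    let N₁ := D₄ * lproj D₃
    let S₁ := C₄ * lproj M₁
    ∀ (X₃ : Matrix (Fin m₃) (Fin n₃) ℍ[ℝ]) (X₄ : Matrix (Fin m₄) (Fin n₄) ℍ[ℝ]),
      C₃ * X₃ * D₃ + C₄ * X₄ * D₄ = E₁ ↔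
        ∃ (Y₁₁ : Matrix (Fin m₄) (Fin n₄) ℍ[ℝ]) (Y₁₂ Y₁₃ : Matrix (Fin m₃) (Fin n₃) ℍ[ℝ])
          (Y₁₄ Y₁₅ : Matrix (Fin m₄) (Fin n₄) ℍ[ℝ]),
          X₃ = dg C₃ * E₁ * dg D₃ - dg C₃ * C₄ * dg M₁ * E₁ * dg D₃
              - dg C₃ * S₁ * dg C₄ * E₁ * dg N₁ * D₄ * dg D₃
              - dg C₃ * S₁ * Y₁₁ * rproj N₁ * D₄ * dg D₃
              + lproj C₃ * Y₁₂ + Y₁₃ * rproj D₃ ∧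
          X₄ = dg M₁ * E₁ * dg D₄ + dg S₁ * S₁ * dg C₄ * E₁ * dg N₁
              + lproj M₁ * lproj S₁ * Y₁₄ + Y₁₅ * rproj D₄ + lproj M₁ * Y₁₁ * rproj N₁ := by
  intro M₁ N₁ S₁ X₃ X₄
  obtain ⟨U, V, hE⟩ := hcons
  have hM : rproj C₃ * C₄ = M₁ := rfl
  have hN : D₄ * lproj D₃ = N₁ := rfl
  have hS : C₄ * lproj M₁ = S₁ := rfl
  have hMR : dg M₁ * rproj C₃ = dg M₁ := dg_rproj_mul_mul_rproj C₃ C₄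
  have hNL : lproj D₃ * dg N₁ = dg N₁ := lproj_mul_dg_mul_lproj D₃ D₄
  have hSL : lproj M₁ * dg S₁ = dg S₁ := lproj_mul_dg_mul_lproj M₁ C₄
  clear_value S₁ N₁ M₁
  have hMC₃ : dg M₁ * C₃ = 0 := by
    rw [← hMR, Matrix.mul_assoc, rproj_mul, Matrix.mul_zero]
  have hMC₄ : dg M₁ * C₄ = dg M₁ * M₁ := by
    conv_lhs => rw [← hMR, Matrix.mul_assoc, hM]
  have hDN₃ : D₃ * dg N₁ = 0 := by
    rw [← hNL, ← Matrix.mul_assoc, mul_lproj, Matrix.zero_mul]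
  have hDN₄ : D₄ * dg N₁ = N₁ * dg N₁ := by
    conv_lhs => rw [← hNL, ← Matrix.mul_assoc, hN]
  have hCS : C₄ * dg S₁ = S₁ * dg S₁ := by
    conv_lhs => rw [← hSL, ← Matrix.mul_assoc, hS]
  have hCM : C₄ * (dg M₁ * M₁) = C₄ - S₁ := by
    rw [← hS, lproj, Matrix.mul_sub, Matrix.mul_one, sub_sub_cancel]
  have hMCC : M₁ * (dg C₄ * C₄) = M₁ := by
    rw [← hM, Matrix.mul_assoc, ← Matrix.mul_assoc C₄, mul_dg_mul]
  have hSCC : S₁ * dg C₄ * C₄ = S₁ := by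
    rw [Matrix.mul_assoc, ← sub_sub_cancel C₄ S₁, ← hCM, Matrix.sub_mul, ← Matrix.mul_assoc C₄, mul_dg_mul,
      Matrix.mul_assoc, Matrix.mul_assoc, hMCC]
  have hLL : lproj M₁ * lproj S₁ = lproj M₁ - dg S₁ * S₁ := by
    rw [lproj.eq_1 S₁, Matrix.mul_sub, Matrix.mul_one, ← Matrix.mul_assoc, hSL]
  have hME : dg M₁ * E₁ = dg M₁ * M₁ * V * D₄ := by
    rw [← hE, Matrix.mul_add, ← Matrix.mul_assoc, ← Matrix.mul_assoc, hMC₃, ← Matrix.mul_assoc,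
      ← Matrix.mul_assoc, hMC₄, Matrix.zero_mul, Matrix.zero_mul, zero_add]
  have hEN : E₁ * dg N₁ = C₄ * V * (N₁ * dg N₁) := by
    rw [← hE, Matrix.add_mul, Matrix.mul_assoc, hDN₃, Matrix.mul_zero, zero_add, Matrix.mul_assoc,
      hDN₄]
  have hSEN : S₁ * dg C₄ * E₁ * dg N₁ = S₁ * V * (N₁ * dg N₁) := by
    rw [Matrix.mul_assoc, hEN]
    simp only [← Matrix.mul_assoc, hSCC]
  have hRE : rproj C₃ * E₁ = M₁ * V * D₄ := by
    rw [← hE, Matrix.mul_add, ← Matrix.mul_assoc, ← Matrix.mul_assoc, rproj_mul,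
      ← Matrix.mul_assoc, ← Matrix.mul_assoc, hM, Matrix.zero_mul, Matrix.zero_mul, zero_add]
  have hEL : E₁ * lproj D₃ = C₄ * V * N₁ := by
    rw [← hE, Matrix.add_mul, Matrix.mul_assoc, mul_lproj, Matrix.mul_zero, zero_add,
      Matrix.mul_assoc, hN]
  have hRS : rproj C₃ * S₁ = 0 := by
    rw [← hS, ← Matrix.mul_assoc, hM, mul_lproj]
  have hRN : rproj N₁ * D₄ * lproj D₃ = 0 := by
    rw [Matrix.mul_assoc, hN, rproj_mul]
  -- the value of `C₄ X₄ D₄` for the parametrised `X₄`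
  have hCXD : ∀ Y₁₁ Y₁₄ Y₁₅ : Matrix (Fin m₄) (Fin n₄) ℍ[ℝ],
      C₄ * (dg M₁ * E₁ * dg D₄ + dg S₁ * S₁ * dg C₄ * E₁ * dg N₁
        + lproj M₁ * lproj S₁ * Y₁₄ + Y₁₅ * rproj D₄ + lproj M₁ * Y₁₁ * rproj N₁) * D₄
      = C₄ * dg M₁ * E₁ + S₁ * dg C₄ * E₁ * dg N₁ * D₄ + S₁ * Y₁₁ * rproj N₁ * D₄ := by
    intro Y₁₁ Y₁₄ Y₁₅
    have e1 : C₄ * (dg M₁ * E₁ * dg D₄) * D₄ = C₄ * dg M₁ * E₁ := by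
      have : dg M₁ * E₁ * dg D₄ * D₄ = dg M₁ * E₁ := by
        rw [hME, Matrix.mul_assoc, Matrix.mul_assoc, ← Matrix.mul_assoc D₄, mul_dg_mul]
      rw [Matrix.mul_assoc, this, Matrix.mul_assoc]
    have e2 : C₄ * (dg S₁ * S₁ * dg C₄ * E₁ * dg N₁) * D₄
        = S₁ * dg C₄ * E₁ * dg N₁ * D₄ := by
      simp only [← Matrix.mul_assoc]
      rw [hCS, mul_dg_mul]
    have e3 : C₄ * (lproj M₁ * lproj S₁ * Y₁₄) * D₄ = 0 := by
      simp only [← Matrix.mul_assoc]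
      rw [hS, mul_lproj, Matrix.zero_mul, Matrix.zero_mul]
    have e4 : C₄ * (Y₁₅ * rproj D₄) * D₄ = 0 := by
      rw [Matrix.mul_assoc, Matrix.mul_assoc, rproj_mul, Matrix.mul_zero, Matrix.mul_zero]
    have e5 : C₄ * (lproj M₁ * Y₁₁ * rproj N₁) * D₄ = S₁ * Y₁₁ * rproj N₁ * D₄ := by
      simp only [← Matrix.mul_assoc]
      rw [hS]
    simp only [Matrix.mul_add, Matrix.add_mul]
    rw [e1, e2, e3, e4, e5, add_zero, add_zero]
  have hX₃ : ∀ Y₁₁ : Matrix (Fin m₄) (Fin n₄) ℍ[ℝ],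
      dg C₃ * E₁ * dg D₃ - dg C₃ * C₄ * dg M₁ * E₁ * dg D₃
        - dg C₃ * S₁ * dg C₄ * E₁ * dg N₁ * D₄ * dg D₃
        - dg C₃ * S₁ * Y₁₁ * rproj N₁ * D₄ * dg D₃
      = dg C₃ * (E₁ - (C₄ * dg M₁ * E₁ + S₁ * dg C₄ * E₁ * dg N₁ * D₄
          + S₁ * Y₁₁ * rproj N₁ * D₄)) * dg D₃ := by
    intro Y₁₁
    simp only [Matrix.mul_add, Matrix.add_mul, Matrix.mul_sub, Matrix.sub_mul, Matrix.mul_assoc]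
    abel
  constructor
  · intro h
    have hCXD₃ : E₁ - C₄ * X₄ * D₄ = C₃ * X₃ * D₃ := by rw [← h, add_sub_cancel_right]
    have hX₄ : X₄ = dg M₁ * E₁ * dg D₄ + dg S₁ * S₁ * dg C₄ * E₁ * dg N₁
        + lproj M₁ * lproj S₁ * (X₄ * (N₁ * dg N₁)) + dg M₁ * M₁ * X₄ * rproj D₄
        + lproj M₁ * X₄ * rproj N₁ := by
      have e1 : dg M₁ * E₁ = dg M₁ * M₁ * X₄ * D₄ := by
        rw [← h, Matrix.mul_add, ← Matrix.mul_assoc, ← Matrix.mul_assoc, hMC₃, ← Matrix.mul_assoc,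
          ← Matrix.mul_assoc, hMC₄, Matrix.zero_mul, Matrix.zero_mul, zero_add]
      have e2 : S₁ * dg C₄ * E₁ * dg N₁ = S₁ * X₄ * (N₁ * dg N₁) := by
        rw [← h, Matrix.mul_assoc, Matrix.add_mul, Matrix.mul_assoc (C₃ * X₃), hDN₃,
          Matrix.mul_zero, zero_add, Matrix.mul_assoc _ D₄, hDN₄]
        simp only [← Matrix.mul_assoc, hSCC]
      have e3 : dg S₁ * S₁ * dg C₄ * E₁ * dg N₁ = dg S₁ * S₁ * X₄ * (N₁ * dg N₁) := by
        simpa only [Matrix.mul_assoc] using congrArg (dg S₁ * ·) e2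
      rw [e1, e3, hLL, rproj, rproj, lproj]
      simp only [Matrix.mul_sub, Matrix.sub_mul, Matrix.mul_one, Matrix.one_mul, Matrix.mul_assoc]
      abel
    refine ⟨X₄, X₃ * (D₃ * dg D₃), X₃, X₄ * (N₁ * dg N₁), dg M₁ * M₁ * X₄, ?_, hX₄⟩
    rw [hX₃, ← hCXD X₄ (X₄ * (N₁ * dg N₁)) (dg M₁ * M₁ * X₄), ← hX₄, hCXD₃, rproj, lproj]
    simp only [Matrix.mul_sub, Matrix.sub_mul, Matrix.mul_one, Matrix.one_mul, Matrix.mul_assoc]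
    abel
  · rintro ⟨Y₁₁, Y₁₂, Y₁₃, Y₁₄, Y₁₅, rfl, rfl⟩
    rw [hCXD, hX₃]
    set W := C₄ * dg M₁ * E₁ + S₁ * dg C₄ * E₁ * dg N₁ * D₄ + S₁ * Y₁₁ * rproj N₁ * D₄ with hW
    have hRW : rproj C₃ * (E₁ - W) = 0 := by
      have : rproj C₃ * (C₄ * dg M₁ * E₁) = M₁ * V * D₄ := by
        rw [Matrix.mul_assoc, hME]
        simp only [← Matrix.mul_assoc]
        rw [hM, mul_dg_mul]
      rw [Matrix.mul_sub, hRE, hW, Matrix.mul_add, Matrix.mul_add, this]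
      simp only [← Matrix.mul_assoc]
      simp only [hRS, Matrix.zero_mul, add_zero, sub_self]
    have hWL : (E₁ - W) * lproj D₃ = 0 := by
      have e1 : C₄ * dg M₁ * E₁ * lproj D₃ = C₄ * V * N₁ - S₁ * V * N₁ := by
        rw [Matrix.mul_assoc C₄, hME, Matrix.mul_assoc, Matrix.mul_assoc _ D₄, hN,
          ← Matrix.mul_assoc, ← Matrix.mul_assoc, hCM, Matrix.sub_mul, Matrix.sub_mul]
      have e2 : S₁ * dg C₄ * E₁ * dg N₁ * D₄ * lproj D₃ = S₁ * V * N₁ := by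
        rw [hSEN, Matrix.mul_assoc, hN, Matrix.mul_assoc, mul_dg_mul]
      have e3 : S₁ * Y₁₁ * rproj N₁ * D₄ * lproj D₃ = 0 := by
        rw [Matrix.mul_assoc _ (rproj N₁), Matrix.mul_assoc, hRN, Matrix.mul_zero]
      rw [Matrix.sub_mul, hEL, hW, Matrix.add_mul, Matrix.add_mul, e1, e2, e3]
      abel
    have hl : C₃ * dg C₃ * (E₁ - W) = E₁ - W := by
      rw [rproj, Matrix.sub_mul, Matrix.one_mul, sub_eq_zero] at hRW
      exact hRW.symm
    have hr : (E₁ - W) * (dg D₃ * D₃) = E₁ - W := by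
      rw [lproj, Matrix.mul_sub, Matrix.mul_one, sub_eq_zero] at hWL
      exact hWL.symm
    have hA : C₃ * (dg C₃ * (E₁ - W) * dg D₃) * D₃ = E₁ - W := by
      rw [← Matrix.mul_assoc, ← Matrix.mul_assoc, hl, Matrix.mul_assoc, hr]
    rw [Matrix.mul_add, Matrix.mul_add, Matrix.add_mul, Matrix.add_mul, hA,
      ← Matrix.mul_assoc C₃ (lproj C₃), mul_lproj, Matrix.zero_mul, Matrix.zero_mul, add_zero,
      Matrix.mul_assoc C₃ _ D₃, Matrix.mul_assoc Y₁₃, rproj_mul, Matrix.mul_zero, Matrix.mul_zero,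
      add_zero, sub_add_cancel]
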